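/- There exists a constant c > 0, depending only on C0 and C1, such that for every δ ≥ 0, every (C0,C1)-elliptic symmetric matrix γ and all η, ξ ∈ ℝ^{nN} one has |G_δ(γ,ξ) − G_δ(γ,η)| ≤ c |η − ξ|. -/

import Mathlib

noncomputable section

open Real

/-- The `γ`-inner product on `ℝ^{nN}`. -/
def gInner {n N : ℕ} (γ : Matrix (Fin n) (Fin n) ℝ) (ξ η : Fin N → Fin n → ℝ) : ℝ :=
  ∑ i, ∑ α, ∑ β, γ α β * ξ i α * η i β

/-- The `γ`-norm on `ℝ^{nN}`. -/
def gNorm {n N : ℕ} (γ : Matrix (Fin n) (Fin n) ℝ) (ξ : Fin N → Fin n → ℝ) : ℝ :=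
  Real.sqrt (gInner γ ξ ξ)

/-- The Euclidean norm on `ℝ^{nN}`. -/
def eNorm {n N : ℕ} (ξ : Fin N → Fin n → ℝ) : ℝ :=
  Real.sqrt (∑ i, ∑ α, ξ i α ^ 2)

/-- A symmetric `(C0, C1)`-elliptic matrix. -/
def IsElliptic {n : ℕ} (C0 C1 : ℝ) (γ : Matrix (Fin n) (Fin n) ℝ) : Prop :=
  (∀ α β, γ α β = γ β α) ∧
  ∀ ζ : Fin n → ℝ,
    C0 * ∑ α, ζ α ^ 2 ≤ (∑ α, ∑ β, γ α β * ζ α * ζ β) ∧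
    (∑ α, ∑ β, γ α β * ζ α * ζ β) ≤ C1 * ∑ α, ζ α ^ 2

/-- `h(t) = (t-1)_+^{p-1} / t` (with the convention `h(0) = 0`). -/
def hfun (p t : ℝ) : ℝ := (max (t - 1) 0) ^ (p - 1) / t

/-- `g(t) = (t-1)_+^p / t`. -/
def gfun (p t : ℝ) : ℝ := (max (t - 1) 0) ^ p / t

/-- The derivative of `h` on `(1,∞)`, extended by `0` elsewhere. -/
def hderiv (p s : ℝ) : ℝ :=
  if 1 < s then (s - 1) ^ (p - 2) * ((p - 2) * s + 1) / s ^ 2 else 0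

/-- The derivative of `g` on `(1,∞)`, extended by `0` elsewhere. -/
def gderiv (p s : ℝ) : ℝ :=
  if 1 < s then (s - 1) ^ (p - 1) * ((p - 1) * s + 1) / s ^ 2 else 0

/-- `λ(t) = min{h(t), (p-1)(t-1)^{p-2}}` for `t > 1`, and `0` for `t ≤ 1`. -/
def lamFun (p t : ℝ) : ℝ :=
  if 1 < t then min (hfun p t) ((p - 1) * (t - 1) ^ (p - 2)) else 0

/-- `Λ(t) = max{h(t), (p-1)(t-1)^{p-2}}` for `t > 1`, and `0` for `t ≤ 1`. -/
def LamFun (p t : ℝ) : ℝ :=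
  if 1 < t then max (hfun p t) ((p - 1) * (t - 1) ^ (p - 2)) else 0

/-- The vector field `A_ε(γ, ξ) = h_ε(|ξ|_γ) ξ` (equal to `0` at `ξ = 0`). -/
def Avf {n N : ℕ} (p ε : ℝ) (γ : Matrix (Fin n) (Fin n) ℝ) (ξ : Fin N → Fin n → ℝ) :
    Fin N → Fin n → ℝ :=
  fun i α => (hfun p (gNorm γ ξ) + ε) * ξ i α

/-- The map `G_δ(γ, ξ) = ((|ξ|_γ - 1 - δ)_+ / |ξ|_γ) ξ` (equal to `0` at `ξ = 0`). -/
def Gmap {n N : ℕ} (δ : ℝ) (γ : Matrix (Fin n) (Fin n) ℝ) (ξ : Fin N → Fin n → ℝ) :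
    Fin N → Fin n → ℝ :=
  fun i α => (max (gNorm γ ξ - 1 - δ) 0) / gNorm γ ξ * ξ i α

/-- The bilinear form `𝒜_ε(γ, ξ)` on third-order tensors in `ℝ^{n²N}`. -/
def Aform {n N : ℕ} (p ε : ℝ) (γ : Matrix (Fin n) (Fin n) ℝ) (ξ : Fin N → Fin n → ℝ)
    (η ζ : Fin N → Fin n → Fin n → ℝ) : ℝ :=
  ∑ i, ∑ j, ∑ α, ∑ β, ∑ ν, ∑ σ,
    ((hfun p (gNorm γ ξ) + ε) * γ α β * (if i = j then (1 : ℝ) else 0) +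
        hderiv p (gNorm γ ξ) / gNorm γ ξ *
          (∑ d, γ α d * ξ i d) * (∑ k, γ β k * ξ j k)) *
      γ ν σ * η i α ν * ζ j β σ

/-- The bilinear form `ℬ_ε(γ, ξ)` on `ℝ^{nN}`. -/
def Bform {n N : ℕ} (p ε : ℝ) (γ : Matrix (Fin n) (Fin n) ℝ) (ξ : Fin N → Fin n → ℝ)
    (η ζ : Fin N → Fin n → ℝ) : ℝ :=
  ∑ i, ∑ j, ∑ α, ∑ β,
    ((hfun p (gNorm γ ξ) + ε) * γ α β * (if i = j then (1 : ℝ) else 0) +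
        hderiv p (gNorm γ ξ) / gNorm γ ξ *
          (∑ d, γ α d * ξ i d) * (∑ k, γ β k * ξ j k)) *
      η i α * ζ j β

/-- The bilinear form `𝒞_ε(γ, ξ)` on `ℝ^n`. -/
def Cform {n N : ℕ} (p ε : ℝ) (γ : Matrix (Fin n) (Fin n) ℝ) (ξ : Fin N → Fin n → ℝ)
    (ζ ζ' : Fin n → ℝ) : ℝ :=
  ∑ α, ∑ β,
    ((hfun p (gNorm γ ξ) + ε) * γ α β +
        hderiv p (gNorm γ ξ) / gNorm γ ξ *
          (∑ i, (∑ d, γ α d * ξ i d) * (∑ k, γ β k * ξ i k))) *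
      ζ α * ζ' β

/-- The squared `γ`-norm of a third-order tensor in `ℝ^{n²N}`. -/
def tNormSq {n N : ℕ} (γ : Matrix (Fin n) (Fin n) ℝ) (η : Fin N → Fin n → Fin n → ℝ) : ℝ :=
  ∑ i, ∑ α, ∑ β, ∑ ν, ∑ σ, γ α β * γ ν σ * η i α ν * η i β σ

/-- The `γ`-inner product is symmetric when `γ` is. -/
theorem gInner_comm {n N : ℕ} {γ : Matrix (Fin n) (Fin n) ℝ} (hγ : ∀ α β, γ α β = γ β α)
    (ξ η : Fin N → Fin n → ℝ) : gInner γ ξ η = gInner γ η ξ := by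
  unfold gInner
  refine Finset.sum_congr rfl fun i _ => ?_
  rw [Finset.sum_comm]
  refine Finset.sum_congr rfl fun α _ => Finset.sum_congr rfl fun β _ => ?_
  rw [hγ β α]
  ring

/-- Expansion of the `γ`-inner square of `x ξ - y η`. -/
theorem gInner_smul_sub_smul_self {n N : ℕ} {γ : Matrix (Fin n) (Fin n) ℝ}
    (hγ : ∀ α β, γ α β = γ β α) (ξ η : Fin N → Fin n → ℝ) (x y : ℝ) :
    gInner γ (fun i α => x * ξ i α - y * η i α) (fun i α => x * ξ i α - y * η i α) =
      x ^ 2 * gInner γ ξ ξ - 2 * (x * y) * gInner γ ξ η + y ^ 2 * gInner γ η η := by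
  have h : gInner γ (fun i α => x * ξ i α - y * η i α) (fun i α => x * ξ i α - y * η i α) =
      x ^ 2 * gInner γ ξ ξ - x * y * gInner γ ξ η - x * y * gInner γ η ξ +
        y ^ 2 * gInner γ η η := by
    simp only [gInner, Finset.mul_sum, ← Finset.sum_sub_distrib, ← Finset.sum_add_distrib]
    refine Finset.sum_congr rfl fun i _ => Finset.sum_congr rfl fun α _ =>
      Finset.sum_congr rfl fun β _ => ?_
    ring
  rw [h, gInner_comm hγ η ξ]
  ring

theorem IsElliptic.le_gInner_self {n N : ℕ} {C0 C1 : ℝ} {γ : Matrix (Fin n) (Fin n) ℝ}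
    (hγ : IsElliptic C0 C1 γ) (ξ : Fin N → Fin n → ℝ) :
    C0 * ∑ i, ∑ α, ξ i α ^ 2 ≤ gInner γ ξ ξ := by
  rw [Finset.mul_sum]
  exact Finset.sum_le_sum fun i _ => (hγ.2 (ξ i)).1

theorem IsElliptic.gInner_self_le {n N : ℕ} {C0 C1 : ℝ} {γ : Matrix (Fin n) (Fin n) ℝ}
    (hγ : IsElliptic C0 C1 γ) (ξ : Fin N → Fin n → ℝ) :
    gInner γ ξ ξ ≤ C1 * ∑ i, ∑ α, ξ i α ^ 2 := by
  rw [Finset.mul_sum]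
  exact Finset.sum_le_sum fun i _ => (hγ.2 (ξ i)).2

theorem IsElliptic.gInner_self_nonneg {n N : ℕ} {C0 C1 : ℝ} {γ : Matrix (Fin n) (Fin n) ℝ}
    (hC0 : 0 ≤ C0) (hγ : IsElliptic C0 C1 γ) (ξ : Fin N → Fin n → ℝ) : 0 ≤ gInner γ ξ ξ :=
  (by positivity : 0 ≤ C0 * ∑ i, ∑ α, ξ i α ^ 2).trans (hγ.le_gInner_self ξ)

/-- The Cauchy–Schwarz inequality for the `γ`-inner product. -/
theorem IsElliptic.gInner_le_gNorm_mul_gNorm {n N : ℕ} {C0 C1 : ℝ}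
    {γ : Matrix (Fin n) (Fin n) ℝ} (hC0 : 0 ≤ C0) (hγ : IsElliptic C0 C1 γ)
    (ξ η : Fin N → Fin n → ℝ) : gInner γ ξ η ≤ gNorm γ ξ * gNorm γ η := by
  have hd : discrim (gInner γ ξ ξ) (-2 * gInner γ ξ η) (gInner γ η η) ≤ 0 := by
    refine discrim_le_zero fun x => ?_
    have h := hγ.gInner_self_nonneg hC0 (fun i α => x * ξ i α - 1 * η i α)
    rw [gInner_smul_sub_smul_self hγ.1] at h
    linarith
  rw [discrim] at hd
  rw [gNorm, gNorm, ← Real.sqrt_mul (hγ.gInner_self_nonneg hC0 ξ)]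
  exact Real.le_sqrt_of_sq_le (by linarith)

/-- The radial factor in `Gmap` lies in `[0, 1]`, and multiplying it by the radius recovers the
positive part. -/
theorem max_sub_div_mem {r a : ℝ} (hr : 0 ≤ r) (ha : 0 ≤ a) :
    0 ≤ max (a - r) 0 / a ∧ max (a - r) 0 / a ≤ 1 ∧ max (a - r) 0 / a * a = max (a - r) 0 := by
  refine ⟨by positivity, div_le_one_of_le₀ (max_le (by linarith) ha) ha, ?_⟩
  rcases ha.eq_or_lt with rfl | h
  · simp [hr]
  · exact div_mul_cancel₀ _ h.ne'

/-- `Gmap` is nonexpansive in the `γ`-norm. -/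
theorem IsElliptic.gInner_Gmap_sub_le {n N : ℕ} {C0 C1 δ : ℝ} {γ : Matrix (Fin n) (Fin n) ℝ}
    (hC0 : 0 ≤ C0) (hδ : 0 ≤ δ) (hγ : IsElliptic C0 C1 γ) (ξ η : Fin N → Fin n → ℝ) :
    gInner γ (fun i α => Gmap δ γ ξ i α - Gmap δ γ η i α)
        (fun i α => Gmap δ γ ξ i α - Gmap δ γ η i α) ≤
      gInner γ (fun i α => ξ i α - η i α) (fun i α => ξ i α - η i α) := by
  have hsub := gInner_smul_sub_smul_self hγ.1 ξ η 1 1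
  simp only [one_mul] at hsub
  have ha : gInner γ ξ ξ = gNorm γ ξ ^ 2 := (Real.sq_sqrt (hγ.gInner_self_nonneg hC0 ξ)).symm
  have hb : gInner γ η η = gNorm γ η ^ 2 := (Real.sq_sqrt (hγ.gInner_self_nonneg hC0 η)).symm
  have ha0 : 0 ≤ gNorm γ ξ := Real.sqrt_nonneg _
  have hb0 : 0 ≤ gNorm γ η := Real.sqrt_nonneg _
  have hcs := hγ.gInner_le_gNorm_mul_gNorm hC0 ξ η
  simp only [Gmap]
  rw [hsub, gInner_smul_sub_smul_self hγ.1, ha, hb]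
  generalize gNorm γ ξ = a at *
  generalize gNorm γ η = b at *
  generalize gInner γ ξ η = t at *
  rw [sub_sub, sub_sub]
  obtain ⟨hk0, hk1, hka⟩ := max_sub_div_mem (by linarith : 0 ≤ 1 + δ) ha0
  obtain ⟨hl0, hl1, hlb⟩ := max_sub_div_mem (by linarith : 0 ≤ 1 + δ) hb0
  have hAB : (max (a - (1 + δ)) 0 - max (b - (1 + δ)) 0) ^ 2 ≤ (a - b) ^ 2 := by
    refine sq_le_sq.mpr ((abs_max_sub_max_le_abs _ _ _).trans_eq ?_)
    rw [sub_sub_sub_cancel_right]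
  rw [← hka, ← hlb] at hAB
  generalize max (a - (1 + δ)) 0 / a = k at *
  generalize max (b - (1 + δ)) 0 / b = l at *
  nlinarith [mul_nonneg (sub_nonneg.mpr (mul_le_one₀ hk1 hl0 hl1)) (sub_nonneg.mpr hcs)]

/-- first part of Lemma `lem3`. -/
theorem statement2 (C0 C1 : ℝ) (hC0 : 0 < C0) (hC01 : C0 ≤ C1) :
    ∃ c : ℝ, 0 < c ∧
      ∀ (n N : ℕ), 1 ≤ n → 1 ≤ N →
        ∀ δ : ℝ, 0 ≤ δ →
          ∀ γ : Matrix (Fin n) (Fin n) ℝ, IsElliptic C0 C1 γ →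
            ∀ η ξ : Fin N → Fin n → ℝ,
              eNorm (fun i α => Gmap δ γ ξ i α - Gmap δ γ η i α) ≤
                c * eNorm (fun i α => η i α - ξ i α) := by
  have hC1 : 0 < C1 := hC0.trans_le hC01
  refine ⟨Real.sqrt (C1 / C0), by positivity, fun n N _ _ δ hδ γ hγ η ξ => ?_⟩
  rw [eNorm, eNorm, ← Real.sqrt_mul (by positivity)]
  refine Real.sqrt_le_sqrt ?_
  have h := (hγ.le_gInner_self _).trans
    ((hγ.gInner_Gmap_sub_le hC0.le hδ ξ η).trans (hγ.gInner_self_le _))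
  simp only [fun i α => sub_sq_comm (η i α) (ξ i α)]
  rwa [div_mul_eq_mul_div, le_div_iff₀' hC0]
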